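/- Let n ≥ 1 and let f ∈ A_n with f(z) ≠ 0 for all z ∈ U \ {0} and f'(z) ≠ 0 for all z ∈ U. Let 0 < α ≤ 1/2 be real and let β, γ be complex numbers with γ ≠ 0 and Re(β/γ) > −(n + 1). If |β·(z f'(z)/f(z) − 1) + γ·(z f''(z)/f'(z))| < (1/2)|β + γ(n + 1)| for all z ∈ U, then |f(z)/(z f'(z)) − 1/(2α)| < 1/(2α) for all z ∈ U \ {0}; in particular f ∈ S*(α). -/

import Mathlib

open Complex Metric

/-- Jack's lemma. -/
lemma jack_aux (n : ℕ) (hn : 1 ≤ n) (w : ℂ → ℂ) (z₀ : ℂ) (hz₀ : z₀ ≠ 0) (hz1 : ‖z₀‖ < 1)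
    (hd : DifferentiableOn ℂ w (ball (0 : ℂ) 1)) (hw0 : w 0 = 0)
    (ho : w =o[nhds 0] (fun z ↦ ‖z‖ ^ (n - 1)))
    (hle : ∀ z, ‖z‖ ≤ ‖z₀‖ → ‖w z‖ ≤ 1) (h1 : ‖w z₀‖ = 1) :
    ∃ k : ℝ, (n : ℝ) ≤ k ∧ z₀ * deriv w z₀ = k * w z₀ := by
  have hr : 0 < ‖z₀‖ := norm_pos_iff.mpr hz₀
  have hw : w z₀ ≠ 0 := by rw [← norm_ne_zero_iff, h1]; norm_num
  have hdz : HasDerivAt w (deriv w z₀) z₀ :=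
    (hd.differentiableAt (isOpen_ball.mem_nhds (by simpa using hz1))).hasDerivAt
  have hsch : ∀ z, ‖z‖ < ‖z₀‖ → ‖w z‖ ≤ (‖z‖ / ‖z₀‖) ^ n := by
    intro z hz
    have := dist_le_mul_div_pow_of_mapsTo_ball_of_isLittleO (f := w) (c := 0) (z := z)
      (R₁ := ‖z₀‖) (R₂ := 1) (n := n - 1) (hd.mono (ball_subset_ball hz1.le))
      (by intro x hx
          simp only [mem_ball, dist_zero_right] at hx
          simpa [hw0] using hle x hx.le)
      (by simpa [hw0] using ho) (by simpa using hz)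
    simpa [hw0, Nat.sub_add_cancel hn] using this
  set c : ℂ := z₀ * deriv w z₀ / w z₀ with hc
  have hre : (n : ℝ) ≤ c.re := by
    have hcurve : HasDerivAt (fun t : ℝ ↦ ((t : ℂ) * z₀)) z₀ 1 := by
      simpa using (Complex.ofRealCLM.hasDerivAt (x := (1:ℝ))).mul_const z₀
    have hcomp : HasDerivAt (fun t : ℝ ↦ w ((t : ℂ) * z₀) / w z₀) c 1 := by
      have h2 : HasDerivAt w (deriv w z₀) (((1:ℝ) : ℂ) * z₀) := by simpa using hdz
      have h3 := (h2.comp (1:ℝ) hcurve).div_const (w z₀)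
      simpa [hc, mul_comm, Function.comp_def] using h3
    have hreal : HasDerivAt (fun t : ℝ ↦ (w ((t : ℂ) * z₀) / w z₀).re) c.re 1 := by
      simpa [Function.comp_def] using (Complex.reCLM.hasFDerivAt.comp_hasDerivAt (1:ℝ) hcomp)
    have hphi : HasDerivAt (fun t : ℝ ↦ t ^ n - (w ((t : ℂ) * z₀) / w z₀).re)
        ((n : ℝ) - c.re) 1 := by
      simpa using (hasDerivAt_pow n (1:ℝ)).fun_sub hreal
    have hs := (hasDerivWithinAt_iff_tendsto_slope' (s := Set.Iio (1:ℝ)) (by simp)).mp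
      (hphi.hasDerivWithinAt (s := Set.Iio (1:ℝ)))
    have : (n : ℝ) - c.re ≤ 0 := by
      refine le_of_tendsto hs ?_
      have hev : ∀ᶠ t : ℝ in nhdsWithin 1 (Set.Iio 1), 0 < t :=
        nhdsWithin_le_nhds (lt_mem_nhds (by norm_num))
      filter_upwards [hev, self_mem_nhdsWithin] with t ht0 ht1
      have ht1 : t < 1 := ht1
      rw [slope_def_field]
      apply div_nonpos_of_nonneg_of_nonpos _ (by linarith)
      have e1 : (w (((1:ℝ):ℂ) * z₀) / w z₀).re = 1 := by simp [hw]
      rw [e1]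
      have e2 : ‖(t:ℂ) * z₀‖ = t * ‖z₀‖ := by simp [abs_of_pos ht0]
      have e3 := hsch ((t:ℂ) * z₀) (by rw [e2]; nlinarith)
      rw [e2, mul_div_assoc, div_self hr.ne', mul_one] at e3
      have e4 : (w ((t:ℂ) * z₀) / w z₀).re ≤ ‖w ((t:ℂ) * z₀) / w z₀‖ := Complex.re_le_norm _
      rw [norm_div, h1, div_one] at e4
      simp only [one_pow]
      linarith
    linarith
  have him : c.im = 0 := by
    have hcurve : HasDerivAt (fun t : ℝ ↦ (Complex.exp ((t : ℂ) * I) * z₀)) (I * z₀) 0 := by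
      have h2 : HasDerivAt (fun t : ℝ ↦ (t : ℂ) * I) I 0 := by
        simpa using (Complex.ofRealCLM.hasDerivAt (x := (0:ℝ))).mul_const I
      simpa using h2.cexp.mul_const z₀
    have hcomp : HasDerivAt (fun t : ℝ ↦ w (Complex.exp ((t : ℂ) * I) * z₀) / w z₀)
        (I * c) 0 := by
      have h2 : HasDerivAt w (deriv w z₀) (Complex.exp (((0:ℝ) : ℂ) * I) * z₀) := by
        simpa using hdz
      have h3 := (h2.comp (0:ℝ) hcurve).div_const (w z₀)
      have e : deriv w z₀ * (I * z₀) / w z₀ = I * c := by rw [hc]; ring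
      rw [e] at h3
      exact h3
    have hreal : HasDerivAt (fun t : ℝ ↦ (w (Complex.exp ((t : ℂ) * I) * z₀) / w z₀).re)
        (I * c).re 0 :=
      (Complex.reCLM.hasFDerivAt.comp_hasDerivAt (0:ℝ) hcomp)
    have hmax : IsLocalMax (fun t : ℝ ↦ (w (Complex.exp ((t : ℂ) * I) * z₀) / w z₀).re) 0 := by
      refine Filter.Eventually.of_forall fun t ↦ ?_
      have e1 : (w (Complex.exp (((0:ℝ):ℂ) * I) * z₀) / w z₀).re = 1 := by simp [hw]
      simp only [e1]
      refine (Complex.re_le_norm _).trans ?_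
      rw [norm_div, h1, div_one]
      apply hle
      simp [Complex.norm_exp_ofReal_mul_I]
    have := hmax.hasDerivAt_eq_zero hreal
    simpa using this
  refine ⟨c.re, hre, ?_⟩
  have : (c.re : ℂ) = c := by apply Complex.ext <;> simp [him]
  rw [this, hc]
  field_simp

/-- The function w vanishes to order `n`. -/
lemma order_aux (n : ℕ) (hn : 1 ≤ n) (f : ℂ → ℂ) (hf : AnalyticAt ℂ f 0)
    (hf0 : f 0 = 0) (hf'0 : deriv f 0 = 1)
    (hcoef : ∀ k : ℕ, 2 ≤ k → k ≤ n → iteratedDeriv k f 0 = 0) :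
    (fun z ↦ dslope f 0 z / deriv f z - 1) =o[nhds 0] (fun z ↦ ‖z‖ ^ (n - 1)) := by
  have hid : ∀ k, iteratedDeriv k (fun z : ℂ ↦ z) 0 = if k = 1 then 1 else 0 := by
    intro k
    rcases k with _ | _ | k
    · simp
    · simp
    · simp [iteratedDeriv_succ']
  have hord : ((n + 1 : ℕ) : ℕ∞) ≤ analyticOrderAt (fun z ↦ f z - z) 0 := by
    rw [natCast_le_analyticOrderAt_iff_iteratedDeriv_eq_zero (by fun_prop)]
    intro i hi
    rw [iteratedDeriv_fun_sub hf.contDiffAt (by fun_prop), hid]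
    rcases i with _ | _ | i
    · simp [hf0]
    · simp [hf'0]
    · rw [hcoef _ (by omega) (by omega)]; simp
  obtain ⟨g, hg, hfg⟩ := (natCast_le_analyticOrderAt (by fun_prop)).mp hord
  have hder : ∀ᶠ z in nhds (0:ℂ), deriv f z = 1 + (n + 1) * z ^ n * g z + z ^ (n+1) * deriv g z := by
    filter_upwards [hfg.eventually_nhds, hg.eventually_analyticAt] with z hz hgz
    have : f =ᶠ[nhds z] fun z ↦ z + z ^ (n+1) * g z := by
      filter_upwards [hz] with y hy
      simp at hy
      linear_combination hy
    rw [this.deriv_eq]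
    have h := (hasDerivAt_id z).fun_add ((hasDerivAt_pow (n+1) z).fun_mul hgz.differentiableAt.hasDerivAt)
    have hderiv := h.deriv
    simp only [id] at hderiv
    rw [hderiv]
    push_cast
    ring
  have hne : ∀ᶠ z in nhds (0:ℂ), deriv f z ≠ 0 :=
    hf.deriv.continuousAt.eventually_ne (by simp [hf'0])
  have key : ∀ᶠ z in nhds (0:ℂ), dslope f 0 z / deriv f z - 1
      = z ^ (n - 1) * (z * (-(n:ℂ) * g z - z * deriv g z) / deriv f z) := by
    filter_upwards [hfg, hder, hne] with z h1 h2 h3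
    have hzn : z ^ (n - 1) * z = z ^ n := by
      rw [← pow_succ, Nat.sub_add_cancel hn]
    rcases eq_or_ne z 0 with rfl | hz
    · simp [hf'0]
    · rw [dslope_of_ne _ hz, slope_def_field, hf0]
      simp at h1
      have h4 : f z = z + z ^ (n+1) * g z := by linear_combination h1
      have h5 : z ^ (n - 1) * (z * (-(n:ℂ) * g z - z * deriv g z) / deriv f z)
        = z ^ n * (-(n:ℂ) * g z - z * deriv g z) / deriv f z := by
        rw [← hzn]; ring
      rw [h5, h4]
      field_simp
      rw [h2]
      ring
  have hlim : Filter.Tendsto (fun z ↦ z * (-(n:ℂ) * g z - z * deriv g z) / deriv f z)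
      (nhds 0) (nhds 0) := by
    have hc : ContinuousAt (fun z ↦ z * (-(n:ℂ) * g z - z * deriv g z) / deriv f z) 0 := by
      have a := hg.continuousAt
      have b := hg.deriv.continuousAt
      have d := hf.deriv.continuousAt
      refine ContinuousAt.div (by fun_prop) d (by simp [hf'0])
    simpa using hc.tendsto
  have h := (Asymptotics.isBigO_refl (fun z : ℂ ↦ z ^ (n-1)) (nhds 0)).mul_isLittleO
    ((Asymptotics.isLittleO_one_iff ℂ).mpr hlim)
  have h2 := (Asymptotics.IsLittleO.congr' h (key.mono fun z hz ↦ hz.symm)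
    (Filter.Eventually.of_forall fun z ↦ mul_one _)).norm_right
  simpa using h2



/-- **Theorem 2, case `0 < α ≤ 1/2`.**
If `f ∈ A_n`, nonvanishing on `U \ {0}` with nonvanishing derivative on `U`,
and for complex `β, γ` with `γ ≠ 0`, `Re(β/γ) > −(n + 1)` one has
`|β·(z f'(z)/f(z) − 1) + γ·(z f''(z)/f'(z))| < (1/2)|β + γ(n + 1)|` on `U`,
then `|f(z)/(z f'(z)) − 1/(2α)| < 1/(2α)` on `U`; in particular
`f ∈ S*(α)`, i.e. `Re(z f'(z)/f(z)) > α` on `U`. -/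
theorem mocanu_thm2_starlike_small_alpha
    (n : ℕ) (hn : 1 ≤ n) (f : ℂ → ℂ)
    (hf : AnalyticOn ℂ f (ball (0 : ℂ) 1))
    (hf0 : f 0 = 0) (hf'0 : deriv f 0 = 1)
    (hcoef : ∀ k : ℕ, 2 ≤ k → k ≤ n → iteratedDeriv k f 0 = 0)
    (hfne : ∀ z ∈ ball (0 : ℂ) 1, z ≠ 0 → f z ≠ 0)
    (hf'ne : ∀ z ∈ ball (0 : ℂ) 1, deriv f z ≠ 0)
    (α : ℝ) (hα0 : 0 < α) (hα : α ≤ 1 / 2)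
    (β γ : ℂ) (hγ : γ ≠ 0)
    (hre : -((n : ℝ) + 1) < (β / γ).re)
    (hbound : ∀ z ∈ ball (0 : ℂ) 1, z ≠ 0 →
      ‖β * (z * deriv f z / f z - 1)
          + γ * (z * deriv (deriv f) z / deriv f z)‖
        < (1 / 2) * ‖β + γ * ((n : ℂ) + 1)‖) :
    ∀ z ∈ ball (0 : ℂ) 1, z ≠ 0 →
      ‖f z / (z * deriv f z) - 1 / (2 * α)‖ < 1 / (2 * α) ∧
      α < (z * deriv f z / f z).re := by
  have hU : IsOpen (ball (0:ℂ) 1) := isOpen_ball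
  have hfd : DifferentiableOn ℂ f (ball (0:ℂ) 1) := hf.differentiableOn
  have h0mem : (0:ℂ) ∈ ball (0:ℂ) 1 := by simp
  have hfa : AnalyticAt ℂ f 0 := hfd.analyticAt (hU.mem_nhds h0mem)
  have hdd : DifferentiableOn ℂ (deriv f) (ball (0:ℂ) 1) := hfd.deriv hU
  set w : ℂ → ℂ := fun z ↦ dslope f 0 z / deriv f z - 1 with hwdef
  have hwd : DifferentiableOn ℂ w (ball (0:ℂ) 1) :=
    (((Complex.differentiableOn_dslope (hU.mem_nhds h0mem)).mpr hfd).fun_div hdd hf'ne).sub_const 1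
  have hw0 : w 0 = 0 := by simp [hwdef, hf'0]
  have hwz : ∀ z, z ≠ 0 → w z = f z / (z * deriv f z) - 1 := by
    intro z hz
    simp only [hwdef]
    rw [dslope_of_ne _ hz, slope_def_field, hf0, sub_zero, sub_zero, div_div]
  have ho : w =o[nhds 0] (fun z ↦ ‖z‖ ^ (n - 1)) := order_aux n hn f hfa hf0 hf'0 hcoef
  have main : ∀ z ∈ ball (0:ℂ) 1, ‖w z‖ < 1 := by
    by_contra! hcon
    obtain ⟨z₁, hz₁, hwz₁⟩ := hcon
    have hz₁' : ‖z₁‖ < 1 := by simpa using hz₁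
    have hsub : closedBall (0:ℂ) ‖z₁‖ ⊆ ball 0 1 := closedBall_subset_ball hz₁'
    have hcont : ContinuousOn (fun z ↦ ‖w z‖) (closedBall (0:ℂ) ‖z₁‖) :=
      (hwd.continuousOn.mono hsub).norm
    have hcomp : IsCompact (closedBall (0:ℂ) ‖z₁‖ ∩ (fun z ↦ ‖w z‖) ⁻¹' Set.Ici 1) :=
      (isCompact_closedBall _ _).of_isClosed_subset
        (hcont.preimage_isClosed_of_isClosed isClosed_closedBall isClosed_Ici) Set.inter_subset_left
    obtain ⟨z₀, ⟨hz₀b, hz₀w⟩, hmin⟩ := hcomp.exists_isMinOn ⟨z₁, by simp, hwz₁⟩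
      (continuous_norm.continuousOn)
    have hz₀w : 1 ≤ ‖w z₀‖ := hz₀w
    have hz₀n : ‖z₀‖ ≤ ‖z₁‖ := by simpa using hz₀b
    have hz₀1 : ‖z₀‖ < 1 := hz₀n.trans_lt hz₁'
    have hz₀ne : z₀ ≠ 0 := by
      rintro rfl
      rw [hw0] at hz₀w
      norm_num at hz₀w
    have hlt : ∀ z ∈ ball (0:ℂ) ‖z₀‖, ‖w z‖ ≤ 1 := by
      intro z hz
      by_contra! hc
      have hz' : ‖z‖ < ‖z₀‖ := by simpa using hz
      have := hmin ⟨by simpa using hz'.le.trans hz₀n, hc.le⟩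
      have : ‖z₀‖ ≤ ‖z‖ := this
      linarith
    have hle : ∀ z, ‖z‖ ≤ ‖z₀‖ → ‖w z‖ ≤ 1 := by
      intro z hz
      have hcl : closure (ball (0:ℂ) ‖z₀‖) = closedBall 0 ‖z₀‖ :=
        closure_ball _ (norm_ne_zero_iff.mpr hz₀ne)
      refine le_on_closure (f := fun z ↦ ‖w z‖) (g := fun _ ↦ 1) hlt ?_ continuousOn_const
        (x := z) (by rw [hcl]; simpa using hz)
      rw [hcl]
      exact hcont.mono (closedBall_subset_closedBall hz₀n)
    have heq : ‖w z₀‖ = 1 := le_antisymm (hle z₀ le_rfl) hz₀w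
    obtain ⟨k, hk, hkw⟩ := jack_aux n hn w z₀ hz₀ne hz₀1 hwd hw0 ho hle heq
    have hz₀m : z₀ ∈ ball (0:ℂ) 1 := by simpa using hz₀1
    have hb := hbound z₀ hz₀m hz₀ne
    have hF := hfne z₀ hz₀m hz₀ne
    have hG := hf'ne z₀ hz₀m
    have hderw : deriv w z₀ = (deriv f z₀ * (z₀ * deriv f z₀)
        - f z₀ * (deriv f z₀ + z₀ * deriv (deriv f) z₀)) / (z₀ * deriv f z₀) ^ 2 := by
      have he : w =ᶠ[nhds z₀] fun z ↦ f z / (z * deriv f z) - 1 := by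
        filter_upwards [isOpen_ne.mem_nhds hz₀ne] with z hz using hwz z hz
      rw [he.deriv_eq]
      have d1 := (hfd.differentiableAt (hU.mem_nhds hz₀m)).hasDerivAt
      have d2 := (hdd.differentiableAt (hU.mem_nhds hz₀m)).hasDerivAt
      have d3 := ((d1.fun_div ((hasDerivAt_id z₀).fun_mul d2) (mul_ne_zero hz₀ne hG)).sub_const 1).deriv
      simpa using d3
    have h1w : 1 + w z₀ = f z₀ / (z₀ * deriv f z₀) := by rw [hwz _ hz₀ne]; ring
    have h1wne : 1 + w z₀ ≠ 0 := by
      rw [h1w]; exact div_ne_zero hF (mul_ne_zero hz₀ne hG)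
    have hexpr : β * (z₀ * deriv f z₀ / f z₀ - 1)
          + γ * (z₀ * deriv (deriv f) z₀ / deriv f z₀)
        = -((β + γ) * w z₀ + γ * (z₀ * deriv w z₀)) / (1 + w z₀) := by
      rw [h1w, hderw, hwz _ hz₀ne]
      field_simp
      ring
    have hexpr2 : -((β + γ) * w z₀ + γ * (k * w z₀)) / (1 + w z₀)
        = -(γ * (β / γ + 1 + k) * w z₀) / (1 + w z₀) := by
      field_simp
    have hR : β + γ * ((n:ℂ) + 1) = γ * (β / γ + 1 + n) := by field_simp; ring
    rw [hexpr, hkw, hexpr2, hR, norm_div, norm_neg, norm_mul, norm_mul, heq, mul_one,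
      norm_mul, div_lt_iff₀ (norm_pos_iff.mpr h1wne)] at hb
    have hn2 : ‖1 + w z₀‖ ≤ 2 := by
      refine (norm_add_le _ _).trans ?_
      rw [heq]; norm_num
    have hmono : ‖β / γ + 1 + n‖ ≤ ‖β / γ + 1 + k‖ := by
      rw [Complex.norm_def, Complex.norm_def]
      apply Real.sqrt_le_sqrt
      simp only [Complex.normSq_apply, Complex.add_re, Complex.add_im, Complex.one_re,
        Complex.one_im, Complex.natCast_re, Complex.natCast_im, Complex.ofReal_re,
        Complex.ofReal_im]
      nlinarith
    have hγp : 0 < ‖γ‖ := norm_pos_iff.mpr hγ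
    have s1 : ‖γ‖ * ‖β / γ + 1 + n‖ ≤ ‖γ‖ * ‖β / γ + 1 + k‖ :=
      mul_le_mul_of_nonneg_left hmono hγp.le
    have s2 : 0 ≤ ‖γ‖ * ‖β / γ + 1 + (n:ℂ)‖ := by positivity
    nlinarith
  intro z hz hz0
  have hF := hfne z hz hz0
  have hG := hf'ne z hz
  have hm := main z hz
  rw [hwz z hz0] at hm
  have hinv : z * deriv f z / f z = (f z / (z * deriv f z))⁻¹ := by rw [inv_div]
  have hpne : f z / (z * deriv f z) ≠ 0 := div_ne_zero hF (mul_ne_zero hz0 hG)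
  rw [hinv]
  generalize f z / (z * deriv f z) = p at hm hpne
  have hsq : Complex.normSq p < 2 * p.re := by
    have : ‖p - 1‖ ^ 2 < 1 := by nlinarith [norm_nonneg (p - 1)]
    rw [← Complex.normSq_eq_norm_sq, Complex.normSq_apply] at this
    simp at this
    rw [Complex.normSq_apply]
    nlinarith
  have hpos : 0 < Complex.normSq p := Complex.normSq_pos.mpr hpne
  have hsq2 : α * Complex.normSq p < p.re := by nlinarith
  constructor
  · have ha : (1 / (2 * (α:ℂ))) = ((1 / (2 * α) : ℝ) : ℂ) := by push_cast; rfl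
    rw [ha]
    have hap : 0 < 1 / (2 * α) := by positivity
    have hac : α * (1 / (2 * α)) = 1 / 2 := by field_simp
    generalize 1 / (2 * α) = a at hap hac
    refine lt_of_pow_lt_pow_left₀ 2 hap.le ?_
    rw [← Complex.normSq_eq_norm_sq, Complex.normSq_apply]
    rw [Complex.normSq_apply] at hsq2
    simp
    have := mul_lt_mul_of_pos_left hsq2 hap
    have e : a * (α * (p.re * p.re + p.im * p.im)) = (p.re * p.re + p.im * p.im) / 2 := by
      linear_combination (p.re * p.re + p.im * p.im) * hac
    nlinarith
  · rw [Complex.inv_re, lt_div_iff₀ hpos]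
    exact hsq2
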